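/- For q ∈ (0,1) and τ ∈ S_3, the sequence a_n = P_{n}^q(S_n(τ)) is supermultiplicative-dual: P_{n_1+n_2}^q(S_{n_1+n_2}(τ)) ≤ P_{n_1}^q(S_{n_1}(τ)) · P_{n_2}^q(S_{n_2}(τ)) for all n_1, n_2 ≥ 1. Consequently lim_{n→∞} (P_n^q(S_n(τ)))^{1/n} exists. -/

import Mathlib

open Finset Filter Topology

noncomputable section

/-- Number of inversions of a permutation of `Fin n`. -/
def invCount {n : ℕ} (σ : Equiv.Perm (Fin n)) : ℕ :=
  (Finset.univ.filter (fun p : Fin n × Fin n => p.1 < p.2 ∧ σ p.2 < σ p.1)).card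

/-- Mallows normalization constant `Z_n(q) = ∑_{σ ∈ S_n} q^{inv σ}`. -/
def mallowsZ (n : ℕ) (q : ℝ) : ℝ := ∑ σ : Equiv.Perm (Fin n), q ^ invCount σ

/-- Mallows probability of a permutation. -/
def mallowsP (n : ℕ) (q : ℝ) (σ : Equiv.Perm (Fin n)) : ℝ := q ^ invCount σ / mallowsZ n q

/-- `σ` contains the pattern `τ`. -/
def ContainsPattern {n m : ℕ} (σ : Equiv.Perm (Fin n)) (τ : Equiv.Perm (Fin m)) : Prop :=
  ∃ f : Fin m → Fin n, StrictMono f ∧ ∀ j k : Fin m, τ j < τ k ↔ σ (f j) < σ (f k)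

/-- `σ` avoids the pattern `τ`. -/
def AvoidsPattern {n m : ℕ} (σ : Equiv.Perm (Fin n)) (τ : Equiv.Perm (Fin m)) : Prop :=
  ¬ ContainsPattern σ τ

open scoped Classical in
/-- Mallows probability that a permutation of `[n]` avoids the pattern `τ`,
i.e. `P_n^q(S_n(τ))`. -/
def avoidProb (n : ℕ) (q : ℝ) {m : ℕ} (τ : Equiv.Perm (Fin m)) : ℝ :=
  ∑ σ : Equiv.Perm (Fin n), if AvoidsPattern σ τ then mallowsP n q σ else 0

lemma fekete_aux (a : ℕ → ℝ) (h0 : ∀ n, 0 ≤ a n) (h1 : ∀ n, a n ≤ 1)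
    (hs : ∀ m n, a (m + n) ≤ a m * a n) :
    ∃ L : ℝ, Tendsto (fun n : ℕ => (a n) ^ ((n : ℝ)⁻¹)) atTop (𝓝 L) := by
  set S : Set ℝ := (fun n : ℕ => (a n) ^ ((n : ℝ)⁻¹)) '' Set.Ici 1 with hS
  have hbdd : BddBelow S := ⟨0, by
    rintro _ ⟨n, -, rfl⟩
    exact Real.rpow_nonneg (h0 n) _⟩
  have hne : S.Nonempty := ⟨_, 1, Set.mem_Ici.2 le_rfl, rfl⟩
  refine ⟨sInf S, tendsto_order.2 ⟨?_, ?_⟩⟩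
  · intro b hb
    filter_upwards [eventually_ge_atTop 1] with n hn
    exact hb.trans_le (csInf_le hbdd ⟨n, hn, rfl⟩)
  · intro b hb
    obtain ⟨_, ⟨m, hm, rfl⟩, hmb⟩ := exists_lt_of_csInf_lt hne hb
    have hm1 : 1 ≤ m := hm
    have hmpos : (0 : ℝ) < m := by exact_mod_cast hm1
    have hpow : ∀ k r, a (m * k + r) ≤ a m ^ k := by
      intro k
      induction k with
      | zero => intro r; simpa using h1 r
      | succ k ih =>
        intro r
        have : m * (k + 1) + r = m + (m * k + r) := by ring
        rw [this, pow_succ']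
        exact (hs _ _).trans (mul_le_mul_of_nonneg_left (ih r) (h0 m))
    have hlim : Tendsto (fun n : ℕ => ((n / m : ℕ) : ℝ) * (n : ℝ)⁻¹) atTop (𝓝 ((m : ℝ)⁻¹)) := by
      have h := (tendsto_nat_floor_mul_div_atTop (R := ℝ) (a := (m : ℝ)⁻¹)
        (by positivity)).comp tendsto_natCast_atTop_atTop
      refine h.congr fun n => ?_
      simp only [Function.comp]
      rw [div_eq_mul_inv, ← Nat.floor_div_eq_div (K := ℝ), div_eq_inv_mul]
    have hlim2 : Tendsto (fun n : ℕ => a m ^ (((n / m : ℕ) : ℝ) * (n : ℝ)⁻¹)) atTop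
        (𝓝 (a m ^ ((m : ℝ)⁻¹))) :=
      tendsto_const_nhds.rpow hlim (Or.inr (by positivity))
    filter_upwards [(tendsto_order.1 hlim2).2 b hmb] with n hn
    refine lt_of_le_of_lt ?_ hn
    rw [Real.rpow_mul (h0 m), Real.rpow_natCast]
    apply Real.rpow_le_rpow (h0 n) _ (by positivity)
    have := hpow (n / m) (n % m)
    rwa [Nat.div_add_mod] at this

/-- Index type for the decomposition of a permutation of `Fin (m + n)`. -/
abbrev DecA (m n : ℕ) := {s : Finset (Fin (m + n)) // s.card = m}

lemma DecA.compl {m n : ℕ} (A : DecA m n) : (A.1)ᶜ.card = n := by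
  rw [Finset.card_compl, A.2, Fintype.card_fin]; omega

/-- The shuffle attached to a set of values. -/
def shuf {m n : ℕ} (A : DecA m n) : Fin m ⊕ Fin n ≃ Fin (m + n) :=
  finSumEquivOfFinset A.2 A.compl

/-- Gluing two permutations along a set of values. -/
def glue {m n : ℕ} (x : DecA m n × Equiv.Perm (Fin m) × Equiv.Perm (Fin n)) :
    Equiv.Perm (Fin (m + n)) :=
  finSumFinEquiv.symm.trans ((Equiv.sumCongr x.2.1 x.2.2).trans (shuf x.1))

lemma glue_left {m n : ℕ} (A : DecA m n) (s : Equiv.Perm (Fin m)) (t : Equiv.Perm (Fin n))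
    (i : Fin m) : glue (A, s, t) (Fin.castAdd n i) = A.1.orderEmbOfFin A.2 (s i) := by
  simp [glue, shuf]

lemma glue_right {m n : ℕ} (A : DecA m n) (s : Equiv.Perm (Fin m)) (t : Equiv.Perm (Fin n))
    (i : Fin n) : glue (A, s, t) (Fin.natAdd m i) = (A.1)ᶜ.orderEmbOfFin A.compl (t i) := by
  simp [glue, shuf]

lemma glue_bijective (m n : ℕ) : Function.Bijective (glue (m := m) (n := n)) := by
  rw [Fintype.bijective_iff_injective_and_card]
  constructor
  · rintro ⟨A, s, t⟩ ⟨B, s', t'⟩ h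
    have key : ∀ (A : DecA m n) (s : Equiv.Perm (Fin m)) (t : Equiv.Perm (Fin n)),
        (A.1 : Set (Fin (m + n))) = Set.range (fun i => glue (A, s, t) (Fin.castAdd n i)) := by
      intro A s t
      simp only [glue_left]
      rw [← Finset.range_orderEmbOfFin A.1 A.2]
      exact (s.surjective.range_comp (A.1.orderEmbOfFin A.2)).symm
    have hAB : A = B := by
      apply Subtype.ext
      rw [← Finset.coe_inj, key A s t, key B s' t', h]
    subst hAB
    have hs : s = s' := by
      ext i
      have := congrArg (fun f => f (Fin.castAdd n i)) h
      simp only [glue_left, EmbeddingLike.apply_eq_iff_eq] at this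
      rw [this]
    have ht : t = t' := by
      ext i
      have := congrArg (fun f => f (Fin.natAdd m i)) h
      simp only [glue_right, EmbeddingLike.apply_eq_iff_eq] at this
      rw [this]
    rw [hs, ht]
  · rw [Fintype.card_prod, Fintype.card_prod, Fintype.card_finset_len, Fintype.card_perm,
      Fintype.card_perm, Fintype.card_perm]
    simp only [Fintype.card_fin]
    rw [← mul_assoc]
    rw [Nat.choose_symm_add]
    exact Nat.add_choose_mul_factorial_mul_factorial m n

lemma invCount_eq_sum {n : ℕ} (σ : Equiv.Perm (Fin n)) :
    invCount σ = ∑ i, ∑ j, if i < j ∧ σ j < σ i then 1 else 0 := by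
  rw [invCount, Finset.card_filter, Fintype.sum_prod_type]

/-- Cross inversions. -/
def crossInv {m n : ℕ} (A : DecA m n) : ℕ :=
  ∑ i : Fin m, ∑ j : Fin n,
    if (A.1)ᶜ.orderEmbOfFin A.compl j < A.1.orderEmbOfFin A.2 i then 1 else 0

lemma invCount_glue {m n : ℕ} (A : DecA m n) (s : Equiv.Perm (Fin m))
    (t : Equiv.Perm (Fin n)) :
    invCount (glue (A, s, t)) = crossInv A + (invCount s + invCount t) := by
  have hc : crossInv A = ∑ i : Fin m, ∑ j : Fin n,
    if (A.1)ᶜ.orderEmbOfFin A.compl (t j) < A.1.orderEmbOfFin A.2 (s i) then 1 else 0 := by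
    rw [crossInv, ← Equiv.sum_comp s]
    refine Finset.sum_congr rfl fun i _ => ?_
    rw [← Equiv.sum_comp t]
  have h1 : ∀ (i : Fin m) (j : Fin n), Fin.castAdd n i < Fin.natAdd m j := by
    intro i j
    rw [Fin.lt_def]; simp; omega
  have h2 : ∀ (i : Fin m) (j : Fin n), ¬ Fin.natAdd m j < Fin.castAdd n i := by
    intro i j
    exact (h1 i j).not_gt
  have h3 : ∀ (i j : Fin m), Fin.castAdd n i < Fin.castAdd n j ↔ i < j := by
    intro i j
    exact Iff.rfl
  have h4 : ∀ (i j : Fin n), Fin.natAdd m i < Fin.natAdd m j ↔ i < j := by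
    intro i j
    simp
  rw [hc, invCount_eq_sum, invCount_eq_sum, invCount_eq_sum, Fin.sum_univ_add]
  simp only [Fin.sum_univ_add, glue_left, glue_right, h1, h2, h3, h4, OrderEmbedding.lt_iff_lt,
    true_and, false_and, if_false, Finset.sum_const_zero, Finset.sum_add_distrib]
  ring

lemma glue_avoids {m n k : ℕ} (A : DecA m n) (s : Equiv.Perm (Fin m))
    (t : Equiv.Perm (Fin n)) (τ : Equiv.Perm (Fin k)) (h : AvoidsPattern (glue (A, s, t)) τ) :
    AvoidsPattern s τ ∧ AvoidsPattern t τ := by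
  constructor
  · rintro ⟨f, hf, hτ⟩
    refine h ⟨fun i => Fin.castAdd n (f i), fun i j hij => ?_, fun i j => ?_⟩
    · have := hf hij
      exact this
    · rw [hτ, glue_left, glue_left, OrderEmbedding.lt_iff_lt]
  · rintro ⟨f, hf, hτ⟩
    refine h ⟨fun i => Fin.natAdd m (f i), fun i j hij => ?_, fun i j => ?_⟩
    · have := hf hij
      simpa using this
    · rw [hτ, glue_right, glue_right, OrderEmbedding.lt_iff_lt]

lemma sum_glue {m n : ℕ} (g : Equiv.Perm (Fin (m + n)) → ℝ) :
    ∑ σ, g σ = ∑ A : DecA m n, ∑ s, ∑ t, g (glue (A, s, t)) := by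
  rw [← (glue_bijective m n).sum_comp g, Fintype.sum_prod_type]
  refine Finset.sum_congr rfl fun A _ => ?_
  rw [Fintype.sum_prod_type]

lemma triple_sum {α β γ : Type*} [Fintype α] [Fintype β] [Fintype γ]
    (f : α → ℝ) (g : β → ℝ) (h : γ → ℝ) :
    ∑ a, ∑ b, ∑ c, f a * (g b * h c) = (∑ a, f a) * ((∑ b, g b) * ∑ c, h c) := by
  rw [Finset.sum_mul_sum, Finset.sum_mul]
  simp only [Finset.mul_sum]

lemma mallowsZ_pos (n : ℕ) (q : ℝ) (hq : 0 < q) : 0 < mallowsZ n q :=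
  Finset.sum_pos (fun _ _ => pow_pos hq _) Finset.univ_nonempty

open scoped Classical in
/-- Unnormalized weight of the avoiding permutations. -/
def avoidW (n : ℕ) (q : ℝ) {m : ℕ} (τ : Equiv.Perm (Fin m)) : ℝ :=
  ∑ σ : Equiv.Perm (Fin n), if AvoidsPattern σ τ then q ^ invCount σ else 0

lemma avoidProb_eq (n : ℕ) (q : ℝ) {m : ℕ} (τ : Equiv.Perm (Fin m)) :
    avoidProb n q τ = avoidW n q τ / mallowsZ n q := by
  rw [avoidProb, avoidW, Finset.sum_div]
  refine Finset.sum_congr rfl fun σ _ => ?_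
  split_ifs
  · rfl
  · simp

lemma avoidW_nonneg (n : ℕ) (q : ℝ) (hq : 0 < q) {m : ℕ} (τ : Equiv.Perm (Fin m)) :
    0 ≤ avoidW n q τ := by
  refine Finset.sum_nonneg fun σ _ => ?_
  split_ifs <;> positivity

lemma avoidW_le (n : ℕ) (q : ℝ) (hq : 0 < q) {m : ℕ} (τ : Equiv.Perm (Fin m)) :
    avoidW n q τ ≤ mallowsZ n q := by
  refine Finset.sum_le_sum fun σ _ => ?_
  split_ifs
  · exact le_rfl
  · positivity

lemma mallowsZ_add (m n : ℕ) (q : ℝ) :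
    mallowsZ (m + n) q = (∑ A : DecA m n, q ^ crossInv A) * (mallowsZ m q * mallowsZ n q) := by
  rw [mallowsZ, sum_glue]
  simp only [invCount_glue, pow_add]
  exact triple_sum _ _ _

lemma avoidW_add (m n : ℕ) (q : ℝ) (hq : 0 < q) {k : ℕ} (τ : Equiv.Perm (Fin k)) :
    avoidW (m + n) q τ ≤
      (∑ A : DecA m n, q ^ crossInv A) * (avoidW m q τ * avoidW n q τ) := by
  classical
  rw [avoidW, sum_glue, avoidW, avoidW, ← triple_sum]
  refine Finset.sum_le_sum fun A _ => Finset.sum_le_sum fun s _ => Finset.sum_le_sum fun t _ => ?_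
  by_cases h : AvoidsPattern (glue (A, s, t)) τ
  · obtain ⟨h1, h2⟩ := glue_avoids A s t τ h
    rw [if_pos h, if_pos h1, if_pos h2, invCount_glue, pow_add, pow_add]
  · rw [if_neg h]
    split_ifs <;> positivity

lemma avoidProb_add (m n : ℕ) (q : ℝ) (hq : 0 < q) {k : ℕ} (τ : Equiv.Perm (Fin k)) :
    avoidProb (m + n) q τ ≤ avoidProb m q τ * avoidProb n q τ := by
  have hZ := mallowsZ_pos (m + n) q hq
  have hm := mallowsZ_pos m q hq
  have hn := mallowsZ_pos n q hq
  have hW := avoidW_add m n q hq τ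
  rw [avoidProb_eq, avoidProb_eq, avoidProb_eq, div_mul_div_comm, div_le_div_iff₀ hZ (by positivity),
    mallowsZ_add]
  calc _ ≤ _ := mul_le_mul_of_nonneg_right hW (by positivity)
    _ = _ := by ring

/-- Submultiplicativity of the avoidance probabilities, and existence of
`lim_n (P_n^q(S_n(τ)))^{1/n}`. -/
theorem stmt7 (q : ℝ) (hq : q ∈ Set.Ioo (0:ℝ) 1) (τ : Equiv.Perm (Fin 3)) :
    (∀ n₁ n₂ : ℕ, 1 ≤ n₁ → 1 ≤ n₂ →
      avoidProb (n₁ + n₂) q τ ≤ avoidProb n₁ q τ * avoidProb n₂ q τ) ∧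
    ∃ L : ℝ, Tendsto (fun n : ℕ => (avoidProb n q τ) ^ ((n : ℝ)⁻¹)) atTop (𝓝 L) := by
  refine ⟨fun m n _ _ => avoidProb_add m n q hq.1 τ,
    fekete_aux _ (fun n => ?_) (fun n => ?_) (fun m n => avoidProb_add m n q hq.1 τ)⟩
  · rw [avoidProb_eq]
    exact div_nonneg (avoidW_nonneg n q hq.1 τ) (mallowsZ_pos n q hq.1).le
  · rw [avoidProb_eq]
    exact div_le_one_of_le₀ (avoidW_le n q hq.1 τ) (mallowsZ_pos n q hq.1).le
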